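/- Fix d∈ℕ+. There exist 7-layer transformer parameters Θ* with token dimension 4d+8 and at most 8 attention heads per layer such that: for every B≥1, T,L∈ℕ+, U⊆B_d(B), S ≥ max(d·B^{4L}·T^{2L}, 2L), every prompt [h_1,…,h_T]∈P_U(T,L,S) with layer indices w_1,…,w_T, and every z∈[0,1]^d, the tokens h_{T+2}, h_{T+3}, … sequentially generated by TF_{Θ*} from the initial input [h_1,…,h_T, h^D(z,T+1,S)] satisfy, for all ℓ∈[L]: (h_{T+ℓ+1})_{1:d} = W^P_ℓ σ((h_{T+ℓ})_{1:d}) and (h_{T+ℓ+1})_{1:d} ∈ span{(h_j)_{1:d} : j∈[T], w_j = 2ℓ−1}, where W^P_ℓ := Σ_{j'=1}^{T−1} (h_{j'})_{1:d} 1{w_{j'}=2ℓ−1} (h_{j'+1})_{1:d}ᵀ 1{w_{j'+1}=2ℓ} + 1{ℓ=1}·(h_T)_{1:d} 1{w_T=2ℓ−1} Σ_{j'=1}^{T} (h_{j'})_{1:d}ᵀ 1{w_{j'}=2ℓ−1}. -/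

import Mathlib

open scoped BigOperators
open Matrix

noncomputable section

namespace PromptTF

/-- The ReLU activation function. -/
def relu (x : ℝ) : ℝ := max x 0

/-- The elementary universal activation function (EUAF). -/
def euaf (x : ℝ) : ℝ :=
  if 0 ≤ x then |x - 2 * (⌊(x + 1) / 2⌋ : ℝ)| else x / (1 + |x|)

/-- Parameters of one transformer layer (attention heads and a feed-forward net). -/
structure TFLayer (D : ℕ) where
  M : ℕ
  Q : Fin M → Matrix (Fin D) (Fin D) ℝ
  K : Fin M → Matrix (Fin D) (Fin D) ℝ
  V : Fin M → Matrix (Fin D) (Fin D) ℝ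
  width : ℕ
  W1 : Matrix (Fin width) (Fin D) ℝ
  W2 : Matrix (Fin D) (Fin width) ℝ

/-- Self-attention layer applied to a list of tokens. -/
def attnOut {D : ℕ} (θ : TFLayer D) (H : List (Fin D → ℝ)) : List (Fin D → ℝ) :=
  H.map fun h => fun i =>
    h i + ∑ m : Fin θ.M,
      (H.map fun h' =>
        relu (dotProduct ((θ.Q m).mulVec h) ((θ.K m).mulVec h')) * ((θ.V m).mulVec h') i).sum

/-- One transformer layer `FFN ∘ Attn`, with feed-forward activation `act`. -/
def layerMap {D : ℕ} (act : ℝ → ℝ) (θ : TFLayer D) (H : List (Fin D → ℝ)) :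
    List (Fin D → ℝ) :=
  (attnOut θ H).map fun h => fun i =>
    h i + (θ.W2.mulVec fun k => act ((θ.W1.mulVec h) k)) i

/-- Multi-layer transformer, all activations ReLU. -/
def tfForward {D : ℕ} (Θ : List (TFLayer D)) (H : List (Fin D → ℝ)) : List (Fin D → ℝ) :=
  Θ.foldl (fun H' θ => layerMap relu θ H') H

/-- Multi-layer transformer whose first feed-forward layer uses the EUAF activation. -/
def tfForwardEUAF {D : ℕ} (Θ : List (TFLayer D)) (H : List (Fin D → ℝ)) :
    List (Fin D → ℝ) :=
  match Θ with
  | [] => H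
  | θ :: rest => rest.foldl (fun H' θ' => layerMap relu θ' H') (layerMap euaf θ H)

/-- Sequential (autoregressive) generation: append the last output column repeatedly. -/
def genTokens {D : ℕ} (forward : List (Fin D → ℝ) → List (Fin D → ℝ))
    (H : List (Fin D → ℝ)) : ℕ → List (Fin D → ℝ)
  | 0 => H
  | v + 1 =>
      genTokens forward H v ++ [(forward (genTokens forward H v)).getLastD (fun _ => 0)]

/-- The token at one-based position `m` in the generated sequence. -/
def tokenAt {D : ℕ} (forward : List (Fin D → ℝ) → List (Fin D → ℝ))
    (H : List (Fin D → ℝ)) (m : ℕ) : Fin D → ℝ :=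
  (genTokens forward H (m - H.length)).getD (m - 1) (fun _ => 0)

/-- A token with word embedding `u`, layer index `w`, position `j` and scale `S`:
`(uᵀ, 0_{3d+4}ᵀ, 1, S, S·w, S·j)ᵀ ∈ ℝ^{4d+8}`. -/
def promptToken (d : ℕ) (u : Fin d → ℝ) (w : ℤ) (j : ℕ) (S : ℝ) : Fin (4 * d + 8) → ℝ :=
  fun i =>
    if h : (i : ℕ) < d then u ⟨i, h⟩
    else if (i : ℕ) = 4 * d + 4 then 1
    else if (i : ℕ) = 4 * d + 5 then S
    else if (i : ℕ) = 4 * d + 6 then S * w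
    else if (i : ℕ) = 4 * d + 7 then S * j
    else 0

/-- First `d` coordinates of a token. -/
def firstd (d : ℕ) (h : Fin (4 * d + 8) → ℝ) : Fin d → ℝ :=
  fun k => h (Fin.castLE (by omega) k)

/-- Initial input: `T` prompt tokens followed by `N` data tokens. -/
def initialInput (d T N : ℕ) (u : Fin T → Fin d → ℝ) (w : Fin T → ℕ) (S : ℝ)
    (z : Fin N → Fin d → ℝ) : List (Fin (4 * d + 8) → ℝ) :=
  ((List.finRange T).map fun j => promptToken d (u j) (w j) ((j : ℕ) + 1) S)
    ++ ((List.finRange N).map fun i => promptToken d (z i) 0 (T + (i : ℕ) + 1) S)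

/-- The closed Euclidean ball of radius `B` in `ℝ^d`. -/
def eball (d : ℕ) (B : ℝ) : Set (Fin d → ℝ) :=
  {v | Real.sqrt (∑ k, v k ^ 2) ≤ B}

/-- Data of a valid prompt in `P_U(T, L, S)`: word embeddings in `U`,
layer indices in `{1, …, 2L}`. -/
def ValidPrompt {d : ℕ} (U : Set (Fin d → ℝ)) (T L : ℕ)
    (u : Fin T → Fin d → ℝ) (w : Fin T → ℕ) : Prop :=
  (∀ j, u j ∈ U) ∧ ∀ j, 1 ≤ w j ∧ w j ≤ 2 * L

/-- The virtual weight matrix `W^P_ℓ` (without the first-layer correction term). -/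
def WPmat {d T : ℕ} (u : Fin T → Fin d → ℝ) (w : Fin T → ℕ) (ℓ : ℕ) :
    Matrix (Fin d) (Fin d) ℝ :=
  ∑ j : Fin T,
    if h : (j : ℕ) + 1 < T then
      (if w j = 2 * ℓ - 1 ∧ w ⟨(j : ℕ) + 1, h⟩ = 2 * ℓ then
        vecMulVec (u j) (u ⟨(j : ℕ) + 1, h⟩) else 0)
    else 0

/-- The first-layer correction term `(h_T)_{1:d} 1{w_T=1} Σ_{j'} (h_{j'})_{1:d}ᵀ 1{w_{j'}=1}`. -/
def WPcorr {d T : ℕ} (u : Fin T → Fin d → ℝ) (w : Fin T → ℕ) :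
    Matrix (Fin d) (Fin d) ℝ :=
  if hT : 0 < T then
    (if w ⟨T - 1, by omega⟩ = 1 then
      vecMulVec (u ⟨T - 1, by omega⟩) (∑ j : Fin T, if w j = 1 then u j else 0)
    else 0)
  else 0

/-- The virtual first-layer weight matrix `W^P_{1,i}`; `first` indicates `i = 1`. -/
def WPone {d T : ℕ} (u : Fin T → Fin d → ℝ) (w : Fin T → ℕ) (first : Bool) :
    Matrix (Fin d) (Fin d) ℝ :=
  WPmat u w 1 + if first then WPcorr u w else 0

/-- The family of virtual weight matrices of a prompt, for the data token with
zero-based index `i`. -/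
def WPfam {d T : ℕ} (u : Fin T → Fin d → ℝ) (w : Fin T → ℕ) (i : ℕ) :
    ℕ → Matrix (Fin d) (Fin d) ℝ :=
  fun ℓ => if ℓ = 1 then WPone u w (i == 0) else WPmat u w ℓ

/-- Output of the virtual network after `ℓ` layers:
`vnetOut … ℓ = W_ℓ act(W_{ℓ-1} act( ⋯ act(W_1 z) ⋯ ))`. -/
def vnetOut (d : ℕ) (act : ℝ → ℝ) (Ws : ℕ → Matrix (Fin d) (Fin d) ℝ)
    (z : Fin d → ℝ) : ℕ → Fin d → ℝ
  | 0 => z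
  | ℓ + 1 =>
      (Ws (ℓ + 1)).mulVec fun k =>
        if ℓ = 0 then vnetOut d act Ws z ℓ k else act (vnetOut d act Ws z ℓ k)

/-- The emulation property: for every admissible prompt and data tokens, the sequentially
generated tokens realize the virtual neural network encoded by the prompt
(with activation `act`). -/
def EmulatesWith (d : ℕ)
    (forward : List (Fin (4 * d + 8) → ℝ) → List (Fin (4 * d + 8) → ℝ))
    (act : ℝ → ℝ) : Prop :=
  ∀ B : ℝ, 1 ≤ B → ∀ T L : ℕ, 0 < T → 0 < L →
  ∀ U : Set (Fin d → ℝ), U ⊆ eball d B →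
  ∀ S : ℝ, max ((d : ℝ) * B ^ (4 * L) * (T : ℝ) ^ (2 * L)) (2 * (L : ℝ)) ≤ S →
  ∀ (u : Fin T → Fin d → ℝ) (w : Fin T → ℕ), ValidPrompt U T L u w →
  ∀ N : ℕ, 0 < N → ∀ z : Fin N → Fin d → ℝ, (∀ i k, z i k ∈ Set.Icc (0 : ℝ) 1) →
  ∀ (i : Fin N) (ℓ : ℕ), 1 ≤ ℓ → ℓ ≤ L →
    tokenAt forward (initialInput d T N u w S z) (T + N * ℓ + (i : ℕ) + 1)
      = promptToken d (vnetOut d act (WPfam u w (i : ℕ)) (z i) ℓ) (-(ℓ : ℤ))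
          (T + N * ℓ + (i : ℕ) + 1) S

/-- The embedding `x ↦ (xᵀ, 1, 0_{d-p-1}ᵀ)ᵀ ∈ ℝ^d` of an input `x ∈ ℝ^p`. -/
def embed (d p : ℕ) (x : Fin p → ℝ) : Fin d → ℝ :=
  fun k => if h : (k : ℕ) < p then x ⟨k, h⟩ else if (k : ℕ) = p then 1 else 0

/-- The function approximator `f̂_{Θ,H^P,L,p}`: first coordinate of the token at
position `T+1+L` generated from the prompt followed by the single data token. -/
def fhat {d : ℕ} (forward : List (Fin (4 * d + 8) → ℝ) → List (Fin (4 * d + 8) → ℝ))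
    {T : ℕ} (u : Fin T → Fin d → ℝ) (w : Fin T → ℕ) (S : ℝ) (L p : ℕ)
    (x : Fin p → ℝ) : ℝ :=
  tokenAt forward (initialInput d T 1 u w S fun _ => embed d p x) (T + 1 + L)
    ⟨0, by omega⟩

/-- The unit cube `[0,1]^p`. -/
def unitCube (p : ℕ) : Set (Fin p → ℝ) := Set.Icc 0 1

/-- The sup-distance `‖f - g‖_{L^∞([0,1]^p)}`. -/
def supDist (p : ℕ) (f g : (Fin p → ℝ) → ℝ) : ℝ :=
  ⨆ x : unitCube p, |f x.1 - g x.1|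

/-- Partial derivative (within the unit cube) in coordinate direction `i`. -/
def pderivW (p : ℕ) (i : Fin p) (f : (Fin p → ℝ) → ℝ) : (Fin p → ℝ) → ℝ :=
  fun x => fderivWithin ℝ f (unitCube p) x (Pi.single i 1)

/-- Iterated partial derivative along a list of coordinate directions. -/
def pderivList (p : ℕ) : List (Fin p) → ((Fin p → ℝ) → ℝ) → (Fin p → ℝ) → ℝ
  | [], f => f
  | i :: is, f => pderivList p is (pderivW p i f)

/-- The unit ball `C_u^β([0,1]^p)` of `β`-times continuously differentiable functions with
all partial derivatives of order `≤ β` bounded by `1` on the cube. -/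
def Hclass (p β : ℕ) : Set ((Fin p → ℝ) → ℝ) :=
  {f | ContDiffOn ℝ β f (unitCube p) ∧
    ∀ ls : List (Fin p), ls.length ≤ β →
      ∀ x ∈ unitCube p, |pderivList p ls f x| ≤ 1}

/-- `U_{d,r}` : the span of the first `r` standard basis vectors of `ℝ^d`. -/
def spanFirst (d r : ℕ) : Set (Fin d → ℝ) :=
  {v | ∀ k : Fin d, r ≤ (k : ℕ) → v k = 0}

/-- Hidden layers of a standard ReLU network of width `r` (with biases). -/
def nnHidden {p r : ℕ} (W0 : Matrix (Fin r) (Fin p) ℝ) (b0 : Fin r → ℝ)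
    (Wm : ℕ → Matrix (Fin r) (Fin r) ℝ) (bm : ℕ → Fin r → ℝ) (x : Fin p → ℝ) :
    ℕ → Fin r → ℝ
  | 0 => fun i => W0.mulVec x i + b0 i
  | k + 1 => fun i =>
      (Wm k).mulVec (fun j => relu (nnHidden W0 b0 Wm bm x k j)) i + bm k i

/-- The class `N(r,p,L)` of ReLU networks `ℝ^p → ℝ` of width `r` and depth `L`
(`L` affine maps with ReLU in between). -/
def NNclass (r p L : ℕ) : Set ((Fin p → ℝ) → ℝ) :=
  {f | if L = 1 then ∃ (a : Fin p → ℝ) (b : ℝ), f = fun x => (∑ i, a i * x i) + b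
    else ∃ (W0 : Matrix (Fin r) (Fin p) ℝ) (b0 : Fin r → ℝ)
      (Wm : ℕ → Matrix (Fin r) (Fin r) ℝ) (bm : ℕ → Fin r → ℝ)
      (wL : Fin r → ℝ) (bL : ℝ),
      f = fun x => (∑ j, wL j * relu (nnHidden W0 b0 Wm bm x (L - 2) j)) + bL}

/-- Operator norm (w.r.t. the Euclidean norm) of a `d × d` matrix. -/
def opNorm {d : ℕ} (W : Matrix (Fin d) (Fin d) ℝ) : ℝ :=
  ‖LinearMap.toContinuousLinearMap (Matrix.toEuclideanLin W)‖

/-- The class `W(r,d,U,B)` of coarse weight matrices. -/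
def coarseW (d r : ℕ) (U : Set (Fin d → ℝ)) (B : ℝ) :
    Set (Matrix (Fin d) (Fin d) ℝ) :=
  {W | (∃ ut uu : Fin r → Fin d → ℝ,
        (∀ k, ut k ∈ U) ∧ (∀ k, uu k ∈ U) ∧ W = ∑ k, vecMulVec (ut k) (uu k)) ∧
    opNorm W ≤ B ^ 2}

open Classical in
/-- Number of nonzero parameter entries of one transformer layer. -/
def layerNonzero {D : ℕ} (θ : TFLayer D) : ℕ :=
  (Finset.univ.filter fun p : Fin θ.M × Fin D × Fin D => θ.Q p.1 p.2.1 p.2.2 ≠ 0).card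
  + (Finset.univ.filter fun p : Fin θ.M × Fin D × Fin D => θ.K p.1 p.2.1 p.2.2 ≠ 0).card
  + (Finset.univ.filter fun p : Fin θ.M × Fin D × Fin D => θ.V p.1 p.2.1 p.2.2 ≠ 0).card
  + (Finset.univ.filter fun p : Fin θ.width × Fin D => θ.W1 p.1 p.2 ≠ 0).card
  + (Finset.univ.filter fun p : Fin D × Fin θ.width => θ.W2 p.1 p.2 ≠ 0).card

/-- Total number of nonzero parameter entries of a transformer. -/
def tfNonzero {D : ℕ} (Θ : List (TFLayer D)) : ℕ := (Θ.map layerNonzero).sum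

/-- All parameter entries of one layer bounded in absolute value by `c`. -/
def layerEntriesBounded {D : ℕ} (θ : TFLayer D) (c : ℝ) : Prop :=
  (∀ m i j, |θ.Q m i j| ≤ c) ∧ (∀ m i j, |θ.K m i j| ≤ c) ∧ (∀ m i j, |θ.V m i j| ≤ c)
  ∧ (∀ i j, |θ.W1 i j| ≤ c) ∧ ∀ i j, |θ.W2 i j| ≤ c

end PromptTF
end

namespace PromptTF

/-- Block coordinates of a token: four blocks of size `d` and eight scalars. -/
abbrev TokIdx (d : ℕ) := (Fin 4 × Fin d) ⊕ Fin 8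

/-- The block coordinates of `ℝ^{4d+8}`. -/
def tokEquiv (d : ℕ) : TokIdx d ≃ Fin (4 * d + 8) :=
  (Equiv.sumCongr finProdFinEquiv (Equiv.refl _)).trans finSumFinEquiv

/-- A linear endomorphism in block coordinates, as a matrix on `ℝ^{4d+8}`. -/
noncomputable def blockMatrix {d : ℕ} (f : (TokIdx d → ℝ) →ₗ[ℝ] (TokIdx d → ℝ)) :
    Matrix (Fin (4 * d + 8)) (Fin (4 * d + 8)) ℝ :=
  LinearMap.toMatrix' ((LinearEquiv.funCongrLeft ℝ ℝ (tokEquiv d).symm).toLinearMap ∘ₗ f ∘ₗ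
    (LinearEquiv.funCongrLeft ℝ ℝ (tokEquiv d)).toLinearMap)

/-- The transformer layer given by linear maps in block coordinates. -/
noncomputable def blockLayer {d M : ℕ} {κ : Type} [Fintype κ]
    (q k v : Fin M → (TokIdx d → ℝ) →ₗ[ℝ] (TokIdx d → ℝ))
    (inp : (TokIdx d → ℝ) →ₗ[ℝ] (κ → ℝ)) (out : (κ → ℝ) →ₗ[ℝ] (TokIdx d → ℝ)) :
    TFLayer (4 * d + 8) where
  M := M
  Q m := blockMatrix (q m)
  K m := blockMatrix (k m)
  V m := blockMatrix (v m)
  width := Fintype.card κ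
  W1 := LinearMap.toMatrix'
    ((LinearEquiv.funCongrLeft ℝ ℝ (Fintype.equivFin κ).symm).toLinearMap ∘ₗ inp ∘ₗ
      (LinearEquiv.funCongrLeft ℝ ℝ (tokEquiv d)).toLinearMap)
  W2 := LinearMap.toMatrix'
    ((LinearEquiv.funCongrLeft ℝ ℝ (tokEquiv d).symm).toLinearMap ∘ₗ out ∘ₗ
      (LinearEquiv.funCongrLeft ℝ ℝ (Fintype.equivFin κ)).toLinearMap)

lemma blockMatrix_mulVec {d : ℕ} (f : (TokIdx d → ℝ) →ₗ[ℝ] (TokIdx d → ℝ))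
    (h : TokIdx d → ℝ) :
    (blockMatrix f).mulVec (h ∘ (tokEquiv d).symm) = f h ∘ (tokEquiv d).symm := by
  ext i
  simp [blockMatrix, LinearMap.toMatrix'_mulVec, LinearEquiv.funCongrLeft_apply,
    LinearMap.funLeft, Function.comp_assoc]

/-- The attention update in block coordinates. -/
noncomputable def blockAttn {d M : ℕ} (q k v : Fin M → (TokIdx d → ℝ) →ₗ[ℝ] (TokIdx d → ℝ))
    (n : ℕ) (f : ℕ → TokIdx d → ℝ) (i : ℕ) : TokIdx d → ℝ :=
  f i + ∑ m, ∑ j ∈ Finset.range n, relu (q m (f i) ⬝ᵥ k m (f j)) • v m (f j)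

/-- The feed-forward update in block coordinates. -/
def blockFFN {d : ℕ} {κ : Type} (inp : (TokIdx d → ℝ) →ₗ[ℝ] (κ → ℝ))
    (out : (κ → ℝ) →ₗ[ℝ] (TokIdx d → ℝ)) (h : TokIdx d → ℝ) : TokIdx d → ℝ :=
  h + out fun c => relu (inp h c)

lemma list_sum_map_range {α : Type*} [AddCommMonoid α] (n : ℕ) (f : ℕ → α) :
    ((List.range n).map f).sum = ∑ j ∈ Finset.range n, f j := by
  rw [Finset.sum_range, ← List.sum_ofFn, List.ofFn_eq_map, ← List.map_coe_finRange_eq_range,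
    List.map_map]
  rfl

lemma layerMap_blockLayer {d M : ℕ} {κ : Type} [Fintype κ]
    (q k v : Fin M → (TokIdx d → ℝ) →ₗ[ℝ] (TokIdx d → ℝ))
    (inp : (TokIdx d → ℝ) →ₗ[ℝ] (κ → ℝ)) (out : (κ → ℝ) →ₗ[ℝ] (TokIdx d → ℝ))
    (n : ℕ) (f : ℕ → TokIdx d → ℝ) :
    layerMap relu (blockLayer q k v inp out)
        ((List.range n).map fun i => f i ∘ (tokEquiv d).symm)
      = (List.range n).map fun i =>
          blockFFN inp out (blockAttn q k v n f i) ∘ (tokEquiv d).symm := by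
  have attn : attnOut (blockLayer q k v inp out)
      ((List.range n).map fun i => f i ∘ (tokEquiv d).symm)
      = (List.range n).map fun i => blockAttn q k v n f i ∘ (tokEquiv d).symm := by
    simp only [attnOut, List.map_map]
    refine List.map_congr_left fun i _ => ?_
    ext c
    simp only [Function.comp_apply, blockAttn, Pi.add_apply, Finset.sum_apply, Pi.smul_apply,
      smul_eq_mul]
    congr 1
    refine Finset.sum_congr rfl fun m _ => ?_
    rw [← list_sum_map_range]
    congr 1
    refine List.map_congr_left fun j _ => ?_
    simp only [Function.comp_apply, blockLayer, blockMatrix_mulVec]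
    congr 2
    simp only [dotProduct, Function.comp_apply]
    exact Equiv.sum_comp (tokEquiv d).symm fun c => q m (f i) c * k m (f j) c
  rw [layerMap, attn, List.map_map]
  refine List.map_congr_left fun i _ => ?_
  ext c
  simp only [Function.comp_apply, blockLayer, blockFFN, LinearMap.toMatrix'_mulVec, Pi.add_apply]
  congr 1
  refine (congrFun (LinearMap.toMatrix'_mulVec _ _) c).trans ?_
  simp [LinearEquiv.funCongrLeft_apply, LinearMap.funLeft, Function.comp_def]

/-- The layer without heads and hidden units. -/
def idLayer (D : ℕ) : TFLayer D where
  M := 0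
  Q _ := 0
  K _ := 0
  V _ := 0
  width := 0
  W1 := 0
  W2 := 0

lemma layerMap_idLayer {D : ℕ} (H : List (Fin D → ℝ)) : layerMap relu (idLayer D) H = H := by
  have h1 : attnOut (idLayer D) H = H := by
    unfold attnOut
    refine (List.map_congr_left fun h _ => ?_).trans (List.map_id H)
    ext i
    exact (add_eq_left.mpr (Finset.sum_eq_zero fun m _ => m.elim0))
  rw [layerMap, h1]
  refine (List.map_congr_left fun h _ => ?_).trans (List.map_id H)
  ext i
  exact add_eq_left.mpr (congrFun (Matrix.zero_mulVec _) i)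

/-- Tokens in block coordinates. -/
def tokVec {d : ℕ} (x a b e : Fin d → ℝ) (α S w p : ℝ) : TokIdx d → ℝ :=
  Sum.elim (fun c => (![x, a, b, e] : Fin 4 → Fin d → ℝ) c.1 c.2) ![α, 0, 0, 0, 1, S, S * w, S * p]

lemma promptToken_eq {d : ℕ} (x : Fin d → ℝ) (w : ℤ) (p : ℕ) (S : ℝ) :
    promptToken d x w p S = tokVec x 0 0 0 0 S w p ∘ (tokEquiv d).symm := by
  ext i
  obtain ⟨i, rfl⟩ := (tokEquiv d).surjective i
  simp only [Function.comp_apply, Equiv.symm_apply_apply]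
  rcases i with ⟨b, k⟩ | c
  · have hval : ((tokEquiv d (Sum.inl (b, k)) : Fin (4 * d + 8)) : ℕ) = k + d * b := by
      simp [tokEquiv]
    have hk := k.2
    have hlt : (k : ℕ) + d * b < 4 * d := by
      have : d * (b : ℕ) ≤ d * 3 := Nat.mul_le_mul_left _ (by omega)
      omega
    simp only [promptToken, hval, tokVec, Sum.elim_inl]
    by_cases hb : b = 0
    · subst hb
      simp
    · have h1 : ¬ ((k : ℕ) + d * b < d) := by
        have : d * 1 ≤ d * (b : ℕ) :=
          Nat.mul_le_mul_left _ (Nat.one_le_iff_ne_zero.mpr fun h => hb (Fin.ext h))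
        omega
      rw [dif_neg h1, if_neg (by omega), if_neg (by omega), if_neg (by omega), if_neg (by omega)]
      fin_cases b <;> simp at hb ⊢
  · have hval : ((tokEquiv d (Sum.inr c) : Fin (4 * d + 8)) : ℕ) = 4 * d + c := by
      simp [tokEquiv]
    simp only [promptToken, hval, tokVec, Sum.elim_inr]
    rw [dif_neg (by omega)]
    fin_cases c <;> simp

lemma relu_of_nonneg {x : ℝ} (h : 0 ≤ x) : relu x = x := max_eq_left h

lemma relu_of_nonpos {x : ℝ} (h : x ≤ 0) : relu x = 0 := max_eq_right h

lemma relu_sub_relu_neg (x : ℝ) : relu x - relu (-x) = x := by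
  rcases le_total 0 x with h | h
  · rw [relu_of_nonneg h, relu_of_nonpos (by linarith)]; ring
  · rw [relu_of_nonpos h, relu_of_nonneg (by linarith)]; ring

/-- A ReLU hat function detects zero among integer multiples of `S ≥ 1`. -/
lemma relu_hat {S : ℝ} (hS : 1 ≤ S) (t : ℤ) :
    relu (S * t + 1) - 2 * relu (S * t) + relu (S * t - 1) = if t = 0 then 1 else 0 := by
  rcases lt_trichotomy t 0 with h | h | h
  · have h1 : (t : ℝ) ≤ -1 := by exact_mod_cast (by omega : t ≤ -1)
    have : S * t ≤ -1 := by nlinarith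
    rw [if_neg h.ne, relu_of_nonpos (by linarith), relu_of_nonpos (by linarith),
      relu_of_nonpos (by linarith)]
    ring
  · subst h
    simp [relu]
  · have h1 : (1 : ℝ) ≤ t := by exact_mod_cast (by omega : 1 ≤ t)
    have : 1 ≤ S * t := by nlinarith
    rw [if_neg h.ne', relu_of_nonneg (by linarith), relu_of_nonneg (by linarith),
      relu_of_nonneg (by linarith)]
    ring

/-- Four ReLUs multiply `s` by the indicator of `t = 0`. -/
lemma relu_gate {S s : ℝ} (hs : |s| ≤ S) (t : ℤ) :
    relu (s + 2 * (S * t) + S) - relu (-s + 2 * (S * t) + S)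
      - relu (s + 2 * (S * t) - S) + relu (-s + 2 * (S * t) - S)
      = if t = 0 then 2 * s else 0 := by
  obtain ⟨h1, h2⟩ := abs_le.mp hs
  rcases lt_trichotomy t 0 with h | h | h
  · have h3 : (t : ℝ) ≤ -1 := by exact_mod_cast (by omega : t ≤ -1)
    have : S * t ≤ -S := by nlinarith
    rw [if_neg h.ne, relu_of_nonpos (by linarith), relu_of_nonpos (by linarith),
      relu_of_nonpos (by linarith), relu_of_nonpos (by linarith)]
    ring
  · subst h
    rw [Int.cast_zero, relu_of_nonneg (by linarith), relu_of_nonneg (by linarith),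
      relu_of_nonpos (by linarith), relu_of_nonpos (by linarith), if_pos rfl]
    ring
  · have h3 : (1 : ℝ) ≤ t := by exact_mod_cast (by omega : 1 ≤ t)
    have : S ≤ S * t := by nlinarith
    rw [if_neg h.ne', relu_of_nonneg (by linarith), relu_of_nonneg (by linarith),
      relu_of_nonneg (by linarith), relu_of_nonneg (by linarith)]
    ring

end PromptTF

namespace PromptTF

/-- The coordinate `k` of block `b`. -/
abbrev blkF {d : ℕ} (b : Fin 4) (k : Fin d) : (TokIdx d → ℝ) →ₗ[ℝ] ℝ :=
  LinearMap.proj (Sum.inl (b, k))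

/-- The scalar coordinate `c`. -/
abbrev sclF {d : ℕ} (c : Fin 8) : (TokIdx d → ℝ) →ₗ[ℝ] ℝ := LinearMap.proj (Sum.inr c)

/-- The linear map with the given block and scalar components. -/
def blockMap {d : ℕ} {E : Type*} [AddCommMonoid E] [Module ℝ E] (f : Fin 4 → Fin d → E →ₗ[ℝ] ℝ)
    (g : Fin 8 → E →ₗ[ℝ] ℝ) : E →ₗ[ℝ] (TokIdx d → ℝ) :=
  LinearMap.pi (Sum.elim (fun c => f c.1 c.2) g)

@[simp] lemma blockMap_inl {d : ℕ} {E : Type*} [AddCommMonoid E] [Module ℝ E]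
    (f : Fin 4 → Fin d → E →ₗ[ℝ] ℝ) (g : Fin 8 → E →ₗ[ℝ] ℝ) (h : E) (c : Fin 4 × Fin d) :
    blockMap f g h (Sum.inl c) = f c.1 c.2 h := rfl

@[simp] lemma blockMap_inr {d : ℕ} {E : Type*} [AddCommMonoid E] [Module ℝ E]
    (f : Fin 4 → Fin d → E →ₗ[ℝ] ℝ) (g : Fin 8 → E →ₗ[ℝ] ℝ) (h : E) (c : Fin 8) :
    blockMap f g h (Sum.inr c) = g c h := rfl

@[simp] lemma tokVec_inl {d : ℕ} (x a b e : Fin d → ℝ) (α S w p : ℝ) (c : Fin 4 × Fin d) :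
    tokVec x a b e α S w p (Sum.inl c) = (![x, a, b, e] : Fin 4 → Fin d → ℝ) c.1 c.2 := rfl

@[simp] lemma tokVec_inr {d : ℕ} (x a b e : Fin d → ℝ) (α S w p : ℝ) (c : Fin 8) :
    tokVec x a b e α S w p (Sum.inr c)
      = (![α, 0, 0, 0, 1, S, S * w, S * p] : Fin 8 → ℝ) c := rfl

/-- Queries of the first layer: heads `0, 1, 2` look up the next position, heads `3, 4, 5` the
tokens of layer index one. -/
def copyQ (d : ℕ) (m : Fin 6) : (TokIdx d → ℝ) →ₗ[ℝ] (TokIdx d → ℝ) :=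
  blockMap 0 ![sclF 4, if m < 3 then -sclF 7 else 0, 0, 0, 0, 0, 0, 0]

/-- Keys of the first layer. -/
def copyK (d : ℕ) (m : Fin 6) : (TokIdx d → ℝ) →ₗ[ℝ] (TokIdx d → ℝ) :=
  blockMap 0 ![(if m < 3 then sclF 7 else sclF 6) - sclF 5
      + (![1, 0, -1, 1, 0, -1] : Fin 6 → ℝ) m • sclF 4, sclF 4, 0, 0, 0, 0, 0, 0]

/-- Values of the first layer. -/
def copyV (d : ℕ) (m : Fin 6) : (TokIdx d → ℝ) →ₗ[ℝ] (TokIdx d → ℝ) :=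
  (![1, -2, 1, 1, -2, 1] : Fin 6 → ℝ) m •
    if m < 3 then blockMap ![0, blkF 0, 0, 0] ![sclF 6, 0, 0, 0, 0, 0, 0, 0]
    else blockMap ![0, 0, blkF 0, 0] 0

/-- Hidden units of the first feed-forward net. -/
def keyInp (d : ℕ) : (TokIdx d → ℝ) →ₗ[ℝ] (Fin d × Fin 13 → ℝ) :=
  LinearMap.pi fun c =>
    (![blkF 1 c.1 + (2 : ℝ) • (sclF 0 - sclF 6 - sclF 5) + sclF 5,
      -blkF 1 c.1 + (2 : ℝ) • (sclF 0 - sclF 6 - sclF 5) + sclF 5,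
      blkF 1 c.1 + (2 : ℝ) • (sclF 0 - sclF 6 - sclF 5) - sclF 5,
      -blkF 1 c.1 + (2 : ℝ) • (sclF 0 - sclF 6 - sclF 5) - sclF 5,
      blkF 2 c.1 + (2 : ℝ) • (sclF 6 + sclF 0 - sclF 5) + sclF 5,
      -blkF 2 c.1 + (2 : ℝ) • (sclF 6 + sclF 0 - sclF 5) + sclF 5,
      blkF 2 c.1 + (2 : ℝ) • (sclF 6 + sclF 0 - sclF 5) - sclF 5,
      -blkF 2 c.1 + (2 : ℝ) • (sclF 6 + sclF 0 - sclF 5) - sclF 5,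
      blkF 1 c.1, -blkF 1 c.1, blkF 2 c.1, -blkF 2 c.1, blkF 0 c.1] : Fin 13 → _) c.2

/-- A hidden unit of the first feed-forward net. -/
abbrev hidF {d : ℕ} (k : Fin d) (c : Fin 13) : (Fin d × Fin 13 → ℝ) →ₗ[ℝ] ℝ :=
  LinearMap.proj (k, c)

/-- Output weights of the first feed-forward net. -/
noncomputable def keyOut (d : ℕ) : (Fin d × Fin 13 → ℝ) →ₗ[ℝ] (TokIdx d → ℝ) :=
  blockMap ![0,
    fun k => ∑ c : Fin 13, (![2⁻¹, -2⁻¹, -2⁻¹, 2⁻¹, 2⁻¹, -2⁻¹, -2⁻¹, 2⁻¹, -1, 1, 0, 0, 0] :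
      Fin 13 → ℝ) c • hidF k c,
    fun k => hidF k 11 - hidF k 10,
    fun k => hidF k 12] 0

/-- Queries of the second layer. -/
def readQ (d : ℕ) (m : Fin 4) : (TokIdx d → ℝ) →ₗ[ℝ] (TokIdx d → ℝ) :=
  blockMap ![fun k => (![1, -1, 1, -1] : Fin 4 → ℝ) m • blkF 3 k, 0, 0, 0]
    ![sclF 4, (4 : ℝ) • sclF 6, 0, 0, 0, 0, 0, 0]

/-- Keys of the second layer. -/
def readK (d : ℕ) (m : Fin 4) : (TokIdx d → ℝ) →ₗ[ℝ] (TokIdx d → ℝ) :=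
  blockMap ![blkF 1, 0, 0, 0]
    ![(2 : ℝ) • sclF 6 - (2 : ℝ) • sclF 5 + (![1, 1, -1, -1] : Fin 4 → ℝ) m • sclF 5,
      sclF 4, 0, 0, 0, 0, 0, 0]

/-- Values of the second layer. -/
noncomputable def readV (d : ℕ) (m : Fin 4) : (TokIdx d → ℝ) →ₗ[ℝ] (TokIdx d → ℝ) :=
  (![2⁻¹, -2⁻¹, -2⁻¹, 2⁻¹] : Fin 4 → ℝ) m • blockMap ![0, 0, blkF 0, 0] 0

/-- Hidden units computing positive and negative parts of all coordinates. -/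
def splitInp (d : ℕ) : (TokIdx d → ℝ) →ₗ[ℝ] (TokIdx d ⊕ TokIdx d → ℝ) :=
  LinearMap.pi (Sum.elim (fun c => LinearMap.proj c) fun c => -LinearMap.proj c)

/-- The output of a feed-forward net with hidden units `splitInp` that adds `N h` to `h`. -/
def splitOut {d : ℕ} (N : (TokIdx d → ℝ) →ₗ[ℝ] (TokIdx d → ℝ)) :
    (TokIdx d ⊕ TokIdx d → ℝ) →ₗ[ℝ] (TokIdx d → ℝ) :=
  N ∘ₗ LinearMap.pi fun c => (LinearMap.proj (Sum.inl c) : (TokIdx d ⊕ TokIdx d → ℝ) →ₗ[ℝ] ℝ)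
    - LinearMap.proj (Sum.inr c)

lemma blockFFN_split {d : ℕ} (N : (TokIdx d → ℝ) →ₗ[ℝ] (TokIdx d → ℝ)) (h : TokIdx d → ℝ) :
    blockFFN (splitInp d) (splitOut N) h = h + N h := by
  rw [blockFFN, splitOut, LinearMap.comp_apply]
  congr 2
  ext c
  exact relu_sub_relu_neg (h c)

/-- The linear update that turns a read-out into the next generated token. -/
def advance (d : ℕ) : (TokIdx d → ℝ) →ₗ[ℝ] (TokIdx d → ℝ) :=
  blockMap ![fun k => blkF 2 k - blkF 0 k, fun k => -blkF 1 k, fun k => -blkF 2 k,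
      fun k => -blkF 3 k]
    ![-sclF 0, 0, 0, 0, 0, 0, -sclF 5, sclF 5]

/-- The seven-layer transformer. -/
noncomputable def readerTF (d : ℕ) : List (TFLayer (4 * d + 8)) :=
  blockLayer (copyQ d) (copyK d) (copyV d) (keyInp d) (keyOut d) ::
    blockLayer (readQ d) (readK d) (readV d) (splitInp d) (splitOut (advance d)) ::
      List.replicate 5 (idLayer (4 * d + 8))

/-- The embedding of the next token, zero at the last one. -/
def nextEmb {d : ℕ} (n : ℕ) (X : ℕ → Fin d → ℝ) (i : ℕ) : Fin d → ℝ :=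
  if i + 1 < n then X (i + 1) else 0

/-- The layer index of the next token, zero at the last one. -/
def nextIdx (n : ℕ) (W : ℕ → ℤ) (i : ℕ) : ℤ := if i + 1 < n then W (i + 1) else 0

/-- The sum of the embeddings with layer index one. -/
def firstSum {d : ℕ} (n : ℕ) (X : ℕ → Fin d → ℝ) (W : ℕ → ℤ) : Fin d → ℝ :=
  ∑ i ∈ Finset.range n, if W i = 1 then X i else 0

/-- The vector against which the activation is tested at token `i`. -/
def keyVec {d : ℕ} (n : ℕ) (X : ℕ → Fin d → ℝ) (W : ℕ → ℤ) (i : ℕ) : Fin d → ℝ :=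
  (if nextIdx n W i - W i - 1 = 0 then nextEmb n X i else 0)
    + if W i + nextIdx n W i - 1 = 0 then firstSum n X W else 0

/-- The embedding read out from a token with layer index `w` and activation `a`. -/
def readOut {d : ℕ} (n : ℕ) (X : ℕ → Fin d → ℝ) (W : ℕ → ℤ) (w : ℤ) (a : Fin d → ℝ) :
    Fin d → ℝ :=
  ∑ i ∈ Finset.range n, if W i - 1 + 2 * w = 0 then (a ⬝ᵥ keyVec n X W i) • X i else 0

lemma sum_range_hat {S : ℝ} (hS : 1 ≤ S) (n : ℕ) (t : ℕ → ℤ) (g : ℕ → ℝ) :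
    ∑ j ∈ Finset.range n, relu (S * t j + 1) * g j
        + -∑ j ∈ Finset.range n, relu (S * t j) * (2 * g j)
        + ∑ j ∈ Finset.range n, relu (S * t j + -1) * g j
      = ∑ j ∈ Finset.range n, if t j = 0 then g j else 0 := by
  rw [← Finset.sum_neg_distrib, ← Finset.sum_add_distrib, ← Finset.sum_add_distrib]
  refine Finset.sum_congr rfl fun j _ => ?_
  have h := relu_hat hS (t j)
  rw [sub_eq_add_neg _ (1 : ℝ)] at h
  trans (if t j = 0 then 1 else 0) * g j
  · rw [← h]; ring
  · rw [ite_mul, one_mul, zero_mul]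

lemma sum_range_next (n i : ℕ) (g : ℕ → ℝ) :
    (∑ j ∈ Finset.range n, if (j : ℤ) - i - 1 = 0 then g j else 0)
      = if i + 1 < n then g (i + 1) else 0 := by
  have (j : ℕ) : ((j : ℤ) - i - 1 = 0) ↔ i + 1 = j := by omega
  simp_rw [this]
  simp

lemma blockAttn_copy {d n : ℕ} {S : ℝ} (hS : 1 ≤ S) (X : ℕ → Fin d → ℝ) (W : ℕ → ℤ) (i : ℕ) :
    blockAttn (copyQ d) (copyK d) (copyV d) n
        (fun i => tokVec (X i) 0 0 0 0 S (W i) ((i + 1 : ℕ) : ℝ)) i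
      = tokVec (X i) (nextEmb n X i) (firstSum n X W) 0 (S * nextIdx n W i) S (W i)
          ((i + 1 : ℕ) : ℝ) := by
  have score (m : Fin 6) (j : ℕ) :
      copyQ d m (tokVec (X i) 0 0 0 0 S (W i) ((i + 1 : ℕ) : ℝ)) ⬝ᵥ
        copyK d m (tokVec (X j) 0 0 0 0 S (W j) ((j + 1 : ℕ) : ℝ))
      = S * ((if m < 3 then (j : ℤ) - i - 1 else W j - 1 : ℤ) : ℝ)
        + (![1, 0, -1, 1, 0, -1] : Fin 6 → ℝ) m := by
    rw [dotProduct, Fintype.sum_sum_type, Fin.sum_univ_eight]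
    fin_cases m <;> simp [copyQ, copyK] <;> ring
  simp only [blockAttn, score]
  ext c
  rcases c with ⟨b, k⟩ | c
  · fin_cases b
    · simp [Fin.sum_univ_six, copyV]
    · have h := sum_range_hat hS n (fun j => (j : ℤ) - i - 1) fun j => X j k
      rw [sum_range_next] at h
      push_cast at h
      simp [Fin.sum_univ_six, copyV, h, nextEmb, ite_apply]
    · have h := sum_range_hat hS n (fun j => W j - 1) fun j => X j k
      push_cast at h
      simp [Fin.sum_univ_six, copyV, h, firstSum, ite_apply, sub_eq_zero]
    · simp [Fin.sum_univ_six, copyV]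
  · have h := sum_range_hat hS n (fun j => (j : ℤ) - i - 1) fun j => S * W j
    rw [sum_range_next] at h
    push_cast at h
    fin_cases c <;> simp [Fin.sum_univ_six, copyV]
    rw [h, nextIdx]
    split_ifs <;> simp

lemma blockFFN_key {d : ℕ} {S : ℝ} {x a b : Fin d → ℝ} {v w : ℤ} {p : ℝ}
    (ha : ∀ k, |a k| ≤ S) (hb : ∀ k, |b k| ≤ S) :
    blockFFN (keyInp d) (keyOut d) (tokVec x a b 0 (S * v) S w p)
      = tokVec x ((if v - w - 1 = 0 then a else 0) + if w + v - 1 = 0 then b else 0) 0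
          (fun k => relu (x k)) (S * v) S w p := by
  ext c
  rcases c with ⟨s, k⟩ | c
  · fin_cases s
    · simp [blockFFN, keyOut]
    · have h1 := relu_gate (ha k) (v - w - 1)
      have h2 := relu_gate (hb k) (w + v - 1)
      have h3 := relu_sub_relu_neg (a k)
      simp [blockFFN, keyOut, keyInp, Fin.sum_univ_succ]
      push_cast [mul_sub, mul_add, mul_one] at h1 h2 ⊢
      rw [ite_apply, ite_apply]
      have h4 : (if v - w - 1 = 0 then a k else 0) = 2⁻¹ * if v - w - 1 = 0 then 2 * a k else 0 := by
        split_ifs <;> ring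
      have h5 : (if w + v - 1 = 0 then b k else 0) = 2⁻¹ * if w + v - 1 = 0 then 2 * b k else 0 := by
        split_ifs <;> ring
      simp only [Pi.zero_apply]
      rw [h4, h5, ← h1, ← h2]
      linarith
    · have h3 := relu_sub_relu_neg (b k)
      simp [blockFFN, keyOut, keyInp]
      linarith
    · simp [blockFFN, keyOut, keyInp]
  · simp [blockFFN, keyOut]

lemma blockAttn_read {d n : ℕ} {S : ℝ} {X κ E : ℕ → Fin d → ℝ} {W : ℕ → ℤ} {α p : ℕ → ℝ} {i : ℕ}
    (hs : ∀ j < n, |E i ⬝ᵥ κ j| ≤ S) :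
    blockAttn (readQ d) (readK d) (readV d) n
        (fun i => tokVec (X i) (κ i) 0 (E i) (α i) S (W i) (p i)) i
      = tokVec (X i) (κ i)
          (∑ j ∈ Finset.range n, if W j - 1 + 2 * W i = 0 then (E i ⬝ᵥ κ j) • X j else 0)
          (E i) (α i) S (W i) (p i) := by
  have score (m : Fin 4) (j : ℕ) :
      readQ d m (tokVec (X i) (κ i) 0 (E i) (α i) S (W i) (p i)) ⬝ᵥ
        readK d m (tokVec (X j) (κ j) 0 (E j) (α j) S (W j) (p j))
      = (![1, -1, 1, -1] : Fin 4 → ℝ) m * (E i ⬝ᵥ κ j)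
        + 2 * (S * ((W j - 1 + 2 * W i : ℤ) : ℝ)) + (![1, 1, -1, -1] : Fin 4 → ℝ) m * S := by
    rw [dotProduct, Fintype.sum_sum_type, Fin.sum_univ_eight, Fintype.sum_prod_type,
      Fin.sum_univ_four, dotProduct, Finset.mul_sum]
    simp [readQ, readK, mul_assoc]
    ring
  simp only [blockAttn, score]
  ext c
  rcases c with ⟨b, k⟩ | c
  · fin_cases b
    · simp [Fin.sum_univ_four, readV]
    · simp [Fin.sum_univ_four, readV]
    · simp [Fin.sum_univ_four, readV]
      rw [← Finset.sum_neg_distrib, ← Finset.sum_neg_distrib, ← Finset.sum_add_distrib,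
        ← Finset.sum_add_distrib, ← Finset.sum_add_distrib]
      refine Finset.sum_congr rfl fun j hj => ?_
      have h := relu_gate (hs j (Finset.mem_range.mp hj)) (W j - 1 + 2 * W i)
      push_cast [sub_eq_add_neg] at h ⊢
      trans (2⁻¹ * if W j + -1 + 2 * W i = 0 then 2 * (E i ⬝ᵥ κ j) else 0) * X j k
      · rw [← h]; ring
      · split_ifs <;> simp
    · simp [Fin.sum_univ_four, readV]
  · simp [Fin.sum_univ_four, readV]

lemma blockFFN_advance {d : ℕ} {S α p : ℝ} {x a b e : Fin d → ℝ} {w : ℝ} :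
    blockFFN (splitInp d) (splitOut (advance d)) (tokVec x a b e α S w p)
      = tokVec b 0 0 0 0 S (w - 1) (p + 1) := by
  rw [blockFFN_split]
  ext c
  rcases c with ⟨s, k⟩ | c
  · fin_cases s <;> simp [advance]
  · fin_cases c <;> simp [advance] <;> ring

lemma tfForward_readerTF {d n : ℕ} {S : ℝ} (hS : 1 ≤ S) {X : ℕ → Fin d → ℝ} {W : ℕ → ℤ}
    (hX : ∀ i < n + 1, ∀ k, |X i k| ≤ S) (hc : ∀ k, |firstSum (n + 1) X W k| ≤ S)
    (hs : ∀ j < n + 1, |(fun k => relu (X n k)) ⬝ᵥ keyVec (n + 1) X W j| ≤ S) :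
    (tfForward (readerTF d)
        ((List.range (n + 1)).map fun i => promptToken d (X i) (W i) (i + 1) S)).getLastD
          (fun _ => 0)
      = promptToken d (readOut (n + 1) X W (W n) fun k => relu (X n k)) (W n - 1) (n + 2) S := by
  have hnext (i : ℕ) (k : Fin d) : |nextEmb (n + 1) X i k| ≤ S := by
    unfold nextEmb
    split_ifs with h
    · exact hX _ h k
    · simpa using (by linarith : (0 : ℝ) ≤ S)
  simp only [promptToken_eq, readerTF, tfForward, List.foldl_cons, List.replicate,
    List.foldl_nil, layerMap_blockLayer, layerMap_idLayer, blockAttn_copy hS,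
    blockFFN_key (hnext _) hc]
  rw [List.range_succ, List.map_append, List.map_singleton, List.getLastD_concat]
  congr 1
  have h := blockAttn_read (X := X) (κ := keyVec (n + 1) X W) (E := fun i k => relu (X i k))
    (W := W) (α := fun i => S * nextIdx (n + 1) W i) (p := fun i => ((i + 1 : ℕ) : ℝ)) hs
  simp only [keyVec] at h
  rw [h, blockFFN_advance]
  push_cast
  rw [add_assoc, one_add_one_eq_two]
  rfl

end PromptTF

namespace PromptTF

variable {d T : ℕ} (u : Fin T → Fin d → ℝ) (w : Fin T → ℕ) (z : Fin d → ℝ)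

/-- The weight matrix of layer `ℓ`, including the first-layer correction. -/
def promptMat (ℓ : ℕ) : Matrix (Fin d) (Fin d) ℝ :=
  if ℓ = 1 then WPone u w true else WPmat u w ℓ

/-- The output of the first `ℓ` layers of the virtual network. -/
def layerOut : ℕ → Fin d → ℝ
  | 0 => z
  | ℓ + 1 => (promptMat u w (ℓ + 1)).mulVec fun k => relu (layerOut ℓ k)

/-- The embeddings of the prompt followed by those of the generated tokens. -/
def embSeq (i : ℕ) : Fin d → ℝ :=
  if h : i < T then u ⟨i, h⟩ else layerOut u w z (i - T)

/-- The layer indices of the prompt followed by those of the generated tokens. -/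
def idxSeq (i : ℕ) : ℤ := if h : i < T then (w ⟨i, h⟩ : ℤ) else -((i - T : ℕ) : ℤ)

/-- The vector against which the activation is tested at a prompt token. -/
def promptKey (i : Fin T) : Fin d → ℝ :=
  if h : (i : ℕ) + 1 < T then if w ⟨i + 1, h⟩ = w i + 1 then u ⟨i + 1, h⟩ else 0
  else if w i = 1 then ∑ j : Fin T, if w j = 1 then u j else 0 else 0

variable {u w z}

lemma sum_range_eq_sum_fin {E : Type*} [AddCommMonoid E] {n : ℕ} (hn : T ≤ n) {f : ℕ → E}
    (hf : ∀ i, T ≤ i → i < n → f i = 0) :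
    ∑ i ∈ Finset.range n, f i = ∑ i : Fin T, f i := by
  rw [← Finset.sum_range, ← Finset.sum_subset (Finset.range_mono hn)]
  intro i hi hi'
  exact hf i (by simpa using hi') (by simpa using hi)

lemma firstSum_embSeq {n : ℕ} (hn : T ≤ n) :
    firstSum n (embSeq u w z) (idxSeq w) = ∑ j : Fin T, if w j = 1 then u j else 0 := by
  rw [firstSum, sum_range_eq_sum_fin hn]
  · refine Finset.sum_congr rfl fun i _ => ?_
    simp [idxSeq, embSeq]
  · intro i hi _
    rw [idxSeq, dif_neg (by omega), if_neg (by omega)]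

lemma keyVec_embSeq_of_lt (hw : ∀ j, 1 ≤ w j) {n : ℕ} (hn : T ≤ n) (i : Fin T) :
    keyVec (n + 1) (embSeq u w z) (idxSeq w) i = promptKey u w i := by
  have hi := i.2
  have hwi := hw i
  have hidx : nextIdx (n + 1) (idxSeq w) i = idxSeq w (i + 1) := if_pos (by omega)
  have hemb : nextEmb (n + 1) (embSeq u w z) i = embSeq u w z (i + 1) := if_pos (by omega)
  rw [keyVec, firstSum_embSeq (by omega), hidx, hemb, promptKey]
  have h0 : idxSeq w i = w i := by simp [idxSeq]
  by_cases h : (i : ℕ) + 1 < T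
  · have h1 : idxSeq w (i + 1) = w ⟨i + 1, h⟩ := by rw [idxSeq, dif_pos h]
    have h2 : embSeq u w z (i + 1) = u ⟨i + 1, h⟩ := by rw [embSeq, dif_pos h]
    have := hw ⟨i + 1, h⟩
    rw [dif_pos h, h0, h1, h2, if_neg (by omega : ¬ ((w i : ℤ) + w ⟨i + 1, h⟩ - 1 = 0)), add_zero]
    exact if_congr (by omega) rfl rfl
  · have h1 : idxSeq w (i + 1) = 0 := by
      rw [idxSeq, dif_neg h]
      omega
    rw [dif_neg h, h0, h1, if_neg (by omega : ¬ ((0 : ℤ) - w i - 1 = 0)), zero_add]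
    exact if_congr (by omega) rfl rfl

lemma keyVec_embSeq_of_ge {n i : ℕ} (hi : T ≤ i) :
    keyVec (n + 1) (embSeq u w z) (idxSeq w) i = 0 := by
  have h0 : idxSeq w i = -((i - T : ℕ) : ℤ) := by rw [idxSeq, dif_neg (by omega)]
  have h1 : idxSeq w (i + 1) = -((i + 1 - T : ℕ) : ℤ) := by rw [idxSeq, dif_neg (by omega)]
  rw [keyVec, nextIdx, nextEmb, h0, h1]
  split_ifs <;> first | omega | simp

lemma vecMulVec_mulVec_eq (x y a : Fin d → ℝ) : (vecMulVec x y).mulVec a = (a ⬝ᵥ y) • x := by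
  rw [Matrix.vecMulVec_mulVec, dotProduct_comm]
  simp

lemma promptMat_mulVec (ℓ : ℕ) (a : Fin d → ℝ) :
    (promptMat u w (ℓ + 1)).mulVec a
      = ∑ i : Fin T, if w i = 2 * ℓ + 1 then (a ⬝ᵥ promptKey u w i) • u i else 0 := by
  have hmat : (WPmat u w (ℓ + 1)).mulVec a = ∑ i : Fin T,
      if h : (i : ℕ) + 1 < T then
        if w i = 2 * ℓ + 1 then (a ⬝ᵥ promptKey u w i) • u i else 0 else 0 := by
    rw [WPmat, Matrix.sum_mulVec]
    refine Finset.sum_congr rfl fun i _ => ?_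
    by_cases h : (i : ℕ) + 1 < T
    · rw [dif_pos h, dif_pos h, promptKey, dif_pos h]
      by_cases h1 : w i = 2 * ℓ + 1
      · by_cases h2 : w ⟨i + 1, h⟩ = w i + 1
        · rw [if_pos (by omega), if_pos h1, if_pos h2, vecMulVec_mulVec_eq]
        · rw [if_neg (by omega), if_pos h1, if_neg h2]
          simp
      · rw [if_neg (by omega), if_neg h1, Matrix.zero_mulVec]
    · rw [dif_neg h, dif_neg h, Matrix.zero_mulVec]
  have hcorr : (WPcorr u w).mulVec a = ∑ i : Fin T,
      if h : (i : ℕ) + 1 < T then 0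
      else if w i = 1 then (a ⬝ᵥ promptKey u w i) • u i else 0 := by
    rcases Nat.eq_zero_or_pos T with hT | hT
    · subst hT
      simp [WPcorr]
    · rw [WPcorr, dif_pos hT]
      refine Eq.trans ?_ (Finset.sum_eq_single (⟨T - 1, by omega⟩ : Fin T) ?_ ?_).symm
      · rw [dif_neg (by simp; omega)]
        split_ifs with h
        · rw [vecMulVec_mulVec_eq, promptKey, dif_neg (by simp; omega), if_pos h]
        · rw [Matrix.zero_mulVec]
      · intro i _ hi
        rw [dif_pos]
        have := i.2
        have : (i : ℕ) ≠ T - 1 := fun h => hi (Fin.ext h)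
        omega
      · simp
  rw [promptMat]
  by_cases hℓ : ℓ = 0
  · subst hℓ
    rw [if_pos rfl, WPone, if_pos rfl, Matrix.add_mulVec, hmat, hcorr, ← Finset.sum_add_distrib]
    refine Finset.sum_congr rfl fun i _ => ?_
    by_cases h : (i : ℕ) + 1 < T <;> simp [h]
  · rw [if_neg (by omega), hmat]
    refine Finset.sum_congr rfl fun i _ => ?_
    by_cases h : (i : ℕ) + 1 < T
    · rw [dif_pos h]
    · rw [dif_neg h, promptKey, dif_neg h]
      split_ifs with h1 h2
      · omega
      · simp
      · rfl

lemma readOut_embSeq (hw : ∀ j, 1 ≤ w j) (ℓ : ℕ) (a : Fin d → ℝ) :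
    readOut (T + ℓ + 1) (embSeq u w z) (idxSeq w) (-(ℓ : ℤ)) a
      = (promptMat u w (ℓ + 1)).mulVec a := by
  rw [readOut, sum_range_eq_sum_fin (T := T) (by omega), promptMat_mulVec]
  · refine Finset.sum_congr rfl fun i _ => ?_
    rw [keyVec_embSeq_of_lt hw (by omega)]
    have h0 : idxSeq w i = w i := by simp [idxSeq]
    have h1 : embSeq u w z i = u i := by simp [embSeq]
    rw [h0, h1]
    exact if_congr (by omega) rfl rfl
  · intro i hi _
    rw [idxSeq, dif_neg (by omega), if_neg (by omega)]

/-- The Euclidean norm on `ℝ^d`. -/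
noncomputable def eucl (v : Fin d → ℝ) : ℝ := ‖WithLp.toLp 2 v‖

lemma eucl_eq (v : Fin d → ℝ) : eucl v = √(∑ k, v k ^ 2) := by
  simp [eucl, EuclideanSpace.norm_eq]

lemma eucl_nonneg (v : Fin d → ℝ) : 0 ≤ eucl v := norm_nonneg _

lemma abs_le_eucl (v : Fin d → ℝ) (k : Fin d) : |v k| ≤ eucl v := by
  exact PiLp.norm_apply_le (WithLp.toLp 2 v) k

lemma abs_dotProduct_le (a b : Fin d → ℝ) : |a ⬝ᵥ b| ≤ eucl a * eucl b := by
  have h := abs_real_inner_le_norm (WithLp.toLp 2 b) (WithLp.toLp 2 a)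
  rw [EuclideanSpace.inner_toLp_toLp] at h
  simpa [eucl, mul_comm] using h

lemma eucl_relu_le (v : Fin d → ℝ) : eucl (fun k => relu (v k)) ≤ eucl v := by
  rw [eucl_eq, eucl_eq]
  refine Real.sqrt_le_sqrt (Finset.sum_le_sum fun k _ => sq_le_sq.mpr ?_)
  rcases le_total 0 (v k) with h | h
  · rw [relu_of_nonneg h]
  · rw [relu_of_nonpos h]
    simp

lemma eucl_zero : eucl (0 : Fin d → ℝ) = 0 := by simp [eucl]

lemma eucl_smul (c : ℝ) (v : Fin d → ℝ) : eucl (c • v) = |c| * eucl v := by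
  simp [eucl, norm_smul]

lemma eucl_sum_le {ι : Type*} (s : Finset ι) {f : ι → Fin d → ℝ} {b : ℝ}
    (h : ∀ i ∈ s, eucl (f i) ≤ b) : eucl (∑ i ∈ s, f i) ≤ s.card * b := by
  rw [eucl, WithLp.toLp_sum, ← nsmul_eq_mul]
  exact norm_sum_le_of_le s h |>.trans (by simp)

lemma eucl_firstSum_le {B : ℝ} (hB : 0 ≤ B) (hu : ∀ j, eucl (u j) ≤ B) :
    eucl (∑ j : Fin T, if w j = 1 then u j else 0) ≤ T * B := by
  have h := eucl_sum_le Finset.univ (f := fun j => if w j = 1 then u j else 0) (b := B)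
    fun j _ => by
      split_ifs
      · exact hu j
      · rwa [eucl_zero]
  simpa using h

lemma eucl_promptKey_le {B : ℝ} (hB : 0 ≤ B) (hu : ∀ j, eucl (u j) ≤ B) (i : Fin T) :
    eucl (promptKey u w i) ≤ T * B := by
  have hT : (1 : ℝ) ≤ T := by exact_mod_cast i.pos
  rw [promptKey]
  split_ifs
  · exact (hu _).trans (by nlinarith)
  · rw [eucl_zero]; positivity
  · exact eucl_firstSum_le hB hu
  · rw [eucl_zero]; positivity

lemma eucl_promptMat_mulVec_le {B : ℝ} (hB : 0 ≤ B) (hu : ∀ j, eucl (u j) ≤ B) (ℓ : ℕ)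
    (a : Fin d → ℝ) :
    eucl ((promptMat u w (ℓ + 1)).mulVec a) ≤ (T * B) ^ 2 * eucl a := by
  rw [promptMat_mulVec]
  have h := eucl_sum_le Finset.univ
    (f := fun i => if w i = 2 * ℓ + 1 then (a ⬝ᵥ promptKey u w i) • u i else 0)
    (b := eucl a * (T * B) * B) fun i _ => by
      have ha := eucl_nonneg a
      split_ifs
      · rw [eucl_smul]
        exact mul_le_mul ((abs_dotProduct_le _ _).trans
          (mul_le_mul_of_nonneg_left (eucl_promptKey_le hB hu i) ha)) (hu i) (eucl_nonneg _)
          (by positivity)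
      · rw [eucl_zero]; positivity
  refine h.trans (le_of_eq ?_)
  simp
  ring

lemma eucl_layerOut_le {B : ℝ} (hB : 0 ≤ B) (hu : ∀ j, eucl (u j) ≤ B)
    (hz : ∀ k, z k ∈ Set.Icc (0 : ℝ) 1) (ℓ : ℕ) :
    eucl (layerOut u w z ℓ) ≤ √d * (T * B) ^ (2 * ℓ) := by
  induction ℓ with
  | zero =>
    rw [layerOut, eucl_eq, mul_zero, pow_zero, mul_one]
    refine Real.sqrt_le_sqrt ((Finset.sum_le_card_nsmul _ _ 1 fun k _ => ?_).trans (by simp))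
    exact pow_le_one₀ (hz k).1 (hz k).2
  | succ ℓ ih =>
    rw [layerOut]
    refine (eucl_promptMat_mulVec_le hB hu ℓ _).trans ?_
    refine (mul_le_mul_of_nonneg_left ((eucl_relu_le _).trans ih) (by positivity)).trans
      (le_of_eq ?_)
    ring

lemma initialInput_eq (S : ℝ) :
    initialInput d T 1 u (fun j => w j) S (fun _ => z)
      = (List.range (T + 1)).map fun i =>
          promptToken d (embSeq u w z i) (idxSeq w i) (i + 1) S := by
  rw [List.range_succ, List.map_append, initialInput]
  congr 1
  · rw [← List.map_coe_finRange_eq_range, List.map_map]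
    refine List.map_congr_left fun i _ => ?_
    simp [embSeq, idxSeq]
  · simp [embSeq, idxSeq, layerOut, List.finRange_succ]

lemma firstd_promptToken (x : Fin d → ℝ) (v : ℤ) (p : ℕ) (S : ℝ) :
    firstd d (promptToken d x v p S) = x := by
  ext k
  simp [firstd, promptToken]

lemma genTokens_readerTF {B S : ℝ} {L : ℕ} (hd : 0 < d) (hT : 0 < T) (hB : 1 ≤ B)
    (hu : ∀ j, eucl (u j) ≤ B) (hw : ∀ j, 1 ≤ w j) (hz : ∀ k, z k ∈ Set.Icc (0 : ℝ) 1)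
    (hS : (d : ℝ) * B ^ (4 * L) * (T : ℝ) ^ (2 * L) ≤ S) {v : ℕ} (hv : v ≤ L) :
    genTokens (tfForward (readerTF d)) (initialInput d T 1 u w S fun _ => z) v
      = (List.range (T + v + 1)).map fun i =>
          promptToken d (embSeq u w z i) (idxSeq w i) (i + 1) S := by
  have hB0 : 0 ≤ B := by linarith
  have hd1 : (1 : ℝ) ≤ d := by exact_mod_cast hd
  have hT1 : (1 : ℝ) ≤ T := by exact_mod_cast hT
  have hTB : 1 ≤ T * B := one_le_mul_of_one_le_of_one_le hT1 hB
  have hsd1 : 1 ≤ √(d : ℝ) := Real.one_le_sqrt.mpr hd1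
  have hsd : √(d : ℝ) ≤ d := by
    nlinarith [Real.sq_sqrt (by positivity : (0 : ℝ) ≤ d)]
  have bound {m : ℕ} (hm : m ≤ 2 * L) : √d * (T * B) ^ m ≤ S := by
    refine le_trans ?_ hS
    calc √(d : ℝ) * (T * B) ^ m ≤ d * (T * B) ^ (2 * L) :=
          mul_le_mul hsd (pow_le_pow_right₀ hTB hm) (by positivity) (by positivity)
      _ = d * B ^ (2 * L) * T ^ (2 * L) := by ring
      _ ≤ d * B ^ (4 * L) * T ^ (2 * L) := by
          gcongr
          norm_num
  induction v with
  | zero => exact initialInput_eq S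
  | succ v ih =>
    have hpow {m : ℕ} (hm : m ≤ 2 * v + 1) : √d * (T * B) ^ m ≤ S := bound (by omega)
    have hTBS : T * B ≤ S := by
      have := hpow (m := 1) (by omega)
      rw [pow_one] at this
      nlinarith
    have hX (i : ℕ) (hi : i < T + v + 1) (k : Fin d) : |embSeq u w z i k| ≤ S := by
      refine (abs_le_eucl _ k).trans ?_
      rw [embSeq]
      split_ifs with h
      · exact (hu _).trans (by nlinarith)
      · exact (eucl_layerOut_le hB0 hu hz _).trans (hpow (by omega))
    have hlast : embSeq u w z (T + v) = layerOut u w z v := by simp [embSeq]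
    have hidx : idxSeq w (T + v) = -(v : ℤ) := by simp [idxSeq]
    have hs (j : ℕ) (hj : j < T + v + 1) :
        |(fun k => relu (embSeq u w z (T + v) k)) ⬝ᵥ
          keyVec (T + v + 1) (embSeq u w z) (idxSeq w) j| ≤ S := by
      rcases lt_or_ge j T with h | h
      · rw [keyVec_embSeq_of_lt hw (by omega) ⟨j, h⟩, hlast]
        refine (abs_dotProduct_le _ _).trans (le_trans ?_ (hpow le_rfl))
        rw [pow_succ, ← mul_assoc]
        exact mul_le_mul ((eucl_relu_le _).trans (eucl_layerOut_le hB0 hu hz v))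
          (eucl_promptKey_le hB0 hu _) (eucl_nonneg _) (by positivity)
      · rw [keyVec_embSeq_of_ge h, dotProduct_zero, abs_zero]
        linarith
    rw [genTokens, ih (by omega), tfForward_readerTF (by linarith) hX _ hs, hidx,
      readOut_embSeq hw, ← add_assoc T v 1, List.range_succ (n := T + v + 1), List.map_append,
      List.map_singleton, hlast]
    · congr 3
      · rw [add_assoc]
        simp [embSeq, layerOut]
      · rw [add_assoc]
        simp [idxSeq]
        ring
    · intro k
      rw [firstSum_embSeq (by omega)]
      exact (abs_le_eucl _ k).trans ((eucl_firstSum_le hB0 hu).trans hTBS)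

end PromptTF

open PromptTF Matrix

/-- A fixed `7`-layer transformer with at most `8` heads per layer such that,
for every admissible prompt and a single data token, the generated tokens satisfy the
layer-wise recursion `(h_{T+ℓ+1})_{1:d} = W^P_ℓ σ((h_{T+ℓ})_{1:d})` and lie in the span of
the prompt embeddings with layer index `2ℓ−1`. -/
theorem statement_5 (d : ℕ) (hd : 0 < d) :
    ∃ Θ : List (TFLayer (4 * d + 8)),
      Θ.length = 7 ∧ (∀ θ ∈ Θ, θ.M ≤ 8) ∧
      ∀ B : ℝ, 1 ≤ B → ∀ T L : ℕ, 0 < T → 0 < L →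
      ∀ U : Set (Fin d → ℝ), U ⊆ eball d B →
      ∀ S : ℝ, max ((d : ℝ) * B ^ (4 * L) * (T : ℝ) ^ (2 * L)) (2 * (L : ℝ)) ≤ S →
      ∀ (u : Fin T → Fin d → ℝ) (w : Fin T → ℕ), ValidPrompt U T L u w →
      ∀ z : Fin d → ℝ, (∀ k, z k ∈ Set.Icc (0 : ℝ) 1) →
      ∀ ℓ : ℕ, 1 ≤ ℓ → ℓ ≤ L →
        firstd d (tokenAt (tfForward Θ) (initialInput d T 1 u w S fun _ => z) (T + ℓ + 1))
          = (if ℓ = 1 then WPone u w true else WPmat u w ℓ).mulVec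
              (fun k => relu (firstd d
                (tokenAt (tfForward Θ) (initialInput d T 1 u w S fun _ => z) (T + ℓ)) k))
        ∧ firstd d (tokenAt (tfForward Θ) (initialInput d T 1 u w S fun _ => z) (T + ℓ + 1))
            ∈ Submodule.span ℝ {v : Fin d → ℝ | ∃ j : Fin T, w j = 2 * ℓ - 1 ∧ v = u j} := by
  refine ⟨readerTF d, rfl, ?_, ?_⟩
  · intro θ hθ
    simp only [readerTF, List.mem_cons, List.mem_replicate] at hθ
    rcases hθ with rfl | rfl | ⟨-, rfl⟩ <;> simp [blockLayer, idLayer]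
  intro B hB T L hT _ U hU S hS u w hP z hz ℓ hℓ hℓL
  have hu (j : Fin T) : eucl (u j) ≤ B := by
    rw [eucl_eq]
    exact hU (hP.1 j)
  have token {m : ℕ} (hm : m ≤ L) :
      firstd d (tokenAt (tfForward (readerTF d)) (initialInput d T 1 u w S fun _ => z)
        (T + m + 1)) = layerOut u w z m := by
    have hlen : (initialInput d T 1 u w S fun _ => z).length = T + 1 := by simp [initialInput]
    have hm' : T + m + 1 - (T + 1) = m := by omega
    rw [tokenAt, hlen, hm', genTokens_readerTF hd hT hB hu (fun j => (hP.2 j).1) hz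
      ((le_max_left _ _).trans hS) hm, List.getD_eq_getElem _ _ (by simp)]
    simp [firstd_promptToken, embSeq]
  obtain ⟨m, rfl⟩ : ∃ m, ℓ = m + 1 := ⟨ℓ - 1, by omega⟩
  rw [token hℓL, ← add_assoc T m 1, token (by omega)]
  refine ⟨rfl, ?_⟩
  rw [layerOut, promptMat_mulVec]
  refine Submodule.sum_mem _ fun i _ => ?_
  split_ifs with h
  · exact Submodule.smul_mem _ _ (Submodule.subset_span ⟨i, by omega, rfl⟩)
  · exact Submodule.zero_mem _
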